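/- If F=(W,R,P) is a finitely generated descriptive temporal frame, then W is countable. -/

import Mathlib

/-! ## Priorean temporal formulas -/

inductive TMF : Type
  | var : ℕ → TMF
  | top : TMF
  | bot : TMF
  | neg : TMF → TMF
  | and : TMF → TMF → TMF
  | diaF : TMF → TMF
  | diaP : TMF → TMF
deriving DecidableEq

namespace TMF

def or (φ ψ : TMF) : TMF := .neg (.and (.neg φ) (.neg ψ))
def imp (φ ψ : TMF) : TMF := TMF.or (.neg φ) ψ
def boxF (φ : TMF) : TMF := .neg (.diaF (.neg φ))
def boxP (φ : TMF) : TMF := .neg (.diaP (.neg φ))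

def vars : TMF → Finset ℕ
  | .var p => {p}
  | .top => ∅
  | .bot => ∅
  | .neg φ => vars φ
  | .and φ ψ => vars φ ∪ vars ψ
  | .diaF φ => vars φ
  | .diaP φ => vars φ

def sig (φ : TMF) : Set ℕ := ↑(vars φ)

def subs : TMF → Finset TMF
  | .var p => {.var p}
  | .top => {.top}
  | .bot => {.bot}
  | .neg φ => insert (.neg φ) (subs φ)
  | .and φ ψ => insert (.and φ ψ) (subs φ ∪ subs ψ)
  | .diaF φ => insert (.diaF φ) (subs φ)
  | .diaP φ => insert (.diaP φ) (subs φ)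

/-- `|φ|`: the number of subformulas of `φ` together with their negations -/
def size (φ : TMF) : ℕ := ((subs φ) ∪ (subs φ).image TMF.neg).card

end TMF

/-! ## Temporal frames and models -/

/-- a (general) temporal frame -/
structure TFrame (W : Type) where
  R : W → W → Prop
  P : Set (Set W)

namespace TFrame

variable {W : Type}

def diaF (F : TFrame W) (X : Set W) : Set W := {x | ∃ y ∈ X, F.R x y}
def diaP (F : TFrame W) (X : Set W) : Set W := {x | ∃ y ∈ X, F.R y x}

/-- the conditions making `F` a general temporal frame: the relation is transitive and
connected, and the internal sets are closed under the Booleans, `◇_F` and `◇_P` -/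
def IsGeneral (F : TFrame W) : Prop :=
  Nonempty W ∧ Transitive F.R ∧ (∀ x y : W, F.R x y ∨ x = y ∨ F.R y x) ∧
  ∅ ∈ F.P ∧ Set.univ ∈ F.P ∧
  (∀ X ∈ F.P, ∀ Y ∈ F.P, X ∩ Y ∈ F.P) ∧ (∀ X ∈ F.P, Xᶜ ∈ F.P) ∧
  (∀ X ∈ F.P, F.diaF X ∈ F.P) ∧ (∀ X ∈ F.P, F.diaP X ∈ F.P)

/-- differentiated, tight and compact -/
def Descriptive (F : TFrame W) : Prop :=
  (∀ x y : W, (∀ X ∈ F.P, x ∈ X ↔ y ∈ X) → x = y) ∧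
  (∀ x y : W, F.R x y ↔ ∀ X ∈ F.P, y ∈ X → x ∈ F.diaF X) ∧
  (∀ 𝒳 : Set (Set W), 𝒳 ⊆ F.P →
    (∀ 𝒴 : Set (Set W), 𝒴 ⊆ 𝒳 → 𝒴.Finite → (⋂₀ 𝒴).Nonempty) → (⋂₀ 𝒳).Nonempty)

/-- the strict order on clusters -/
def clLT (F : TFrame W) (x y : W) : Prop := F.R x y ∧ ¬ F.R y x

/-- `F` has non-degenerate `R`-final and `R⁻`-final clusters -/
def Serial (F : TFrame W) : Prop :=
  (∃ x, (∀ y, ¬ F.clLT x y) ∧ F.R x x) ∧ (∃ x, (∀ y, ¬ F.clLT y x) ∧ F.R x x)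

/-- between any two distinct degenerate clusters there lies a non-degenerate cluster -/
def DenseFrm (F : TFrame W) : Prop :=
  ∀ x y, ¬ F.R x x → ¬ F.R y y → F.clLT x y → ∃ z, F.R z z ∧ F.clLT x z ∧ F.clLT z y

/-- between any two distinct non-degenerate clusters there lies a degenerate cluster -/
def DedekindComplete (F : TFrame W) : Prop :=
  ∀ x y, F.R x x → F.R y y → F.clLT x y → ∃ z, ¬ F.R z z ∧ F.clLT x z ∧ F.clLT z y

end TFrame

/-- the closure of a family of sets under `∩`, complement, `◇_F` and `◇_P` -/
inductive tgenBy {W : Type} (R : W → W → Prop) (G : Set (Set W)) : Set W → Prop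
  | basic {X : Set W} : X ∈ G → tgenBy R G X
  | empty : tgenBy R G ∅
  | univ : tgenBy R G Set.univ
  | inter {X Y : Set W} : tgenBy R G X → tgenBy R G Y → tgenBy R G (X ∩ Y)
  | compl {X : Set W} : tgenBy R G X → tgenBy R G Xᶜ
  | diaF {X : Set W} : tgenBy R G X → tgenBy R G {x | ∃ y ∈ X, R x y}
  | diaP {X : Set W} : tgenBy R G X → tgenBy R G {x | ∃ y ∈ X, R y x}

def TFrame.FinGenerated {W : Type} (F : TFrame W) : Prop :=
  ∃ G : Set (Set W), G.Finite ∧ F.P = {X | tgenBy F.R G X}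

/-- a temporal model -/
structure TModel (W : Type) where
  F : TFrame W
  v : ℕ → Set W

namespace TModel

variable {W : Type}

def IsModel (M : TModel W) : Prop := M.F.IsGeneral ∧ ∀ p, M.v p ∈ M.F.P

def sat (M : TModel W) : W → TMF → Prop
  | x, .var p => x ∈ M.v p
  | _, .top => True
  | _, .bot => False
  | x, .neg φ => ¬ sat M x φ
  | x, .and φ ψ => sat M x φ ∧ sat M x ψ
  | x, .diaF φ => ∃ y, M.F.R x y ∧ sat M y φ
  | x, .diaP φ => ∃ y, M.F.R y x ∧ sat M y φ

end TModel

def TFrame.Valid {W : Type} (F : TFrame W) (φ : TMF) : Prop :=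
  ∀ v : ℕ → Set W, (∀ p, v p ∈ F.P) → ∀ x, (TModel.mk F v).sat x φ

def TFrame.IsFrameFor {W : Type} (F : TFrame W) (L : Set TMF) : Prop :=
  ∀ φ ∈ L, F.Valid φ

/-- a temporal Kripke frame -/
def tKripke (W : Type) (R : W → W → Prop) : TFrame W := ⟨R, Set.univ⟩

/-! ## The standard temporal logics -/

/-- the logic of all temporal Kripke frames -/
def Lin : Set TMF :=
  {φ | ∀ (W : Type) (R : W → W → Prop), Nonempty W → Transitive R →
        (∀ x y : W, R x y ∨ x = y ∨ R y x) → (tKripke W R).Valid φ}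

def LinQ : Set TMF := {φ | (tKripke ℚ (· < ·)).Valid φ}
def LinR : Set TMF := {φ | (tKripke ℝ (· < ·)).Valid φ}
def LinZ : Set TMF := {φ | (tKripke ℤ (· < ·)).Valid φ}

/-- the logic of all finite strict linear orders -/
def LinFin : Set TMF :=
  {φ | ∀ (W : Type) (_ : Fintype W) (R : W → W → Prop),
        Nonempty W → IsStrictTotalOrder W R → (tKripke W R).Valid φ}

/-! ## Temporal bisimulations and interpolants -/

def TIsBisim {W₁ W₂ : Type} (σ : Set ℕ) (M₁ : TModel W₁) (M₂ : TModel W₂)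
    (β : W₁ → W₂ → Prop) : Prop :=
  ∀ x₁ x₂, β x₁ x₂ →
    (∀ p ∈ σ, x₁ ∈ M₁.v p ↔ x₂ ∈ M₂.v p) ∧
    (∀ y₁, M₁.F.R x₁ y₁ → ∃ y₂, M₂.F.R x₂ y₂ ∧ β y₁ y₂) ∧
    (∀ y₂, M₂.F.R x₂ y₂ → ∃ y₁, M₁.F.R x₁ y₁ ∧ β y₁ y₂) ∧
    (∀ y₁, M₁.F.R y₁ x₁ → ∃ y₂, M₂.F.R y₂ x₂ ∧ β y₁ y₂) ∧
    (∀ y₂, M₂.F.R y₂ x₂ → ∃ y₁, M₁.F.R y₁ x₁ ∧ β y₁ y₂)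

def TBisimilar {W₁ W₂ : Type} (σ : Set ℕ) (M₁ : TModel W₁) (x₁ : W₁)
    (M₂ : TModel W₂) (x₂ : W₂) : Prop :=
  ∃ β, TIsBisim σ M₁ M₂ β ∧ β x₁ x₂

def TIsInterpolant (L : Set TMF) (φ₁ φ₂ ι : TMF) : Prop :=
  ι.sig ⊆ φ₁.sig ∩ φ₂.sig ∧ TMF.imp φ₁ ι ∈ L ∧ TMF.imp ι φ₂ ∈ L

def TNoInterpolant (L : Set TMF) (φ₁ φ₂ : TMF) : Prop := ¬ ∃ ι, TIsInterpolant L φ₁ φ₂ ι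

/-- `J` contains every `R`-intermediate point of any two of its points. -/
def RelConvex {W : Type} (R : W → W → Prop) (J : Set W) : Prop :=
  ∀ ⦃x⦄, x ∈ J → ∀ ⦃y⦄, y ∈ J → ∀ ⦃z⦄, R x z → R z y → z ∈ J

theorem RelConvex.flip {W : Type} {R : W → W → Prop} {J : Set W} (h : RelConvex R J) :
    RelConvex (flip R) J :=
  fun _ hx _ hy _ hxz hzy => h hy hx hzy hxz

/-- The points of `J` that have points of every colour of `J` both above and below them in `J`. -/
def colourCore {W T : Type} (R : W → W → Prop) (τ : W → T) (J : Set W) : Set W :=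
  {x ∈ J | ∀ z ∈ J, (∃ y ∈ J, τ y = τ z ∧ R x y) ∧ ∃ y ∈ J, τ y = τ z ∧ R y x}

theorem RelConvex.colourCore {W T : Type} {R : W → W → Prop} (τ : W → T) {J : Set W}
    (htr : ∀ ⦃x y z⦄, R x y → R y z → R x z) (hJ : RelConvex R J) :
    RelConvex R (colourCore R τ J) := by
  intro x hx y hy z hxz hzy
  refine ⟨hJ hx.1 hy.1 hxz hzy, fun w hw => ⟨?_, ?_⟩⟩
  · obtain ⟨u, hu, hτ, hyu⟩ := (hy.2 w hw).1
    exact ⟨u, hu, hτ, htr hzy hyu⟩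
  · obtain ⟨u, hu, hτ, hux⟩ := (hx.2 w hw).2
    exact ⟨u, hu, hτ, htr hux hxz⟩

/-- If every uncountable convex subset of `J` meets the colour `t`, then all but countably many
points of `J` see a point of `J` of colour `t`. -/
theorem countable_not_seeing {W T : Type} {R : W → W → Prop} {τ : W → T} {J : Set W} {t : T}
    (htr : ∀ ⦃x y z⦄, R x y → R y z → R x z) (hcon : ∀ x y, R x y ∨ x = y ∨ R y x)
    (hJ : RelConvex R J)
    (hmin : ∀ K ⊆ J, RelConvex R K → ¬ K.Countable → t ∈ τ '' K) :
    {x ∈ J | ∀ y ∈ J, τ y = t → ¬ R x y}.Countable := by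
  set B := {x ∈ J | ∀ y ∈ J, τ y = t → ¬ R x y}
  have hsub : {x ∈ B | τ x = t}.Subsingleton := by
    rintro x ⟨hx, hxt⟩ y ⟨hy, hyt⟩
    rcases hcon x y with h | h | h
    · exact absurd h (hx.2 y hy.1 hyt)
    · exact h
    · exact absurd h (hy.2 x hx.1 hxt)
  have hK : {x ∈ B | τ x ≠ t}.Countable := by
    by_contra hunc
    obtain ⟨x, hx, hxt⟩ := hmin {x ∈ B | τ x ≠ t} (fun x hx => hx.1.1) (by
      rintro a ⟨ha, -⟩ b ⟨hb, -⟩ z haz hzb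
      have hzJ := hJ ha.1 hb.1 haz hzb
      exact ⟨⟨hzJ, fun y hy hyt hzy => ha.2 y hy hyt (htr haz hzy)⟩,
        fun hzt => ha.2 z hzJ hzt haz⟩) hunc
    exact hx.2 hxt
  refine (hK.union hsub.countable).mono fun x hx => ?_
  by_cases h : τ x = t
  · exact Or.inr ⟨hx, h⟩
  · exact Or.inl ⟨hx, h⟩

theorem countable_diff_colourCore {W T : Type} {R : W → W → Prop} {τ : W → T} {J : Set W}
    (htr : ∀ ⦃x y z⦄, R x y → R y z → R x z) (hcon : ∀ x y, R x y ∨ x = y ∨ R y x)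
    (hfin : (Set.range τ).Finite) (hJ : RelConvex R J)
    (hmin : ∀ K ⊆ J, RelConvex R K → ¬ K.Countable → τ '' J ⊆ τ '' K) :
    (J \ colourCore R τ J).Countable := by
  have hfinJ : (τ '' J).Finite := hfin.subset (Set.image_subset_range _ _)
  have hU : (⋃ t ∈ τ '' J, {x ∈ J | ∀ y ∈ J, τ y = t → ¬ R x y} ∪
      {x ∈ J | ∀ y ∈ J, τ y = t → ¬ flip R x y}).Countable := by
    refine hfinJ.countable.biUnion fun t ht => Set.Countable.union ?_ ?_
    · exact countable_not_seeing htr hcon hJ fun K hKJ hK hunc => hmin K hKJ hK hunc ht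
    · exact countable_not_seeing (fun _ _ _ hxy hyz => htr hyz hxy)
        (fun x y => (hcon y x).imp id (Or.imp Eq.symm id)) hJ.flip
        fun K hKJ hK hunc => hmin K hKJ hK.flip hunc ht
  refine hU.mono ?_
  rintro x ⟨hxJ, hx⟩
  by_contra hxU
  refine hx ⟨hxJ, fun z hz => ⟨?_, ?_⟩⟩
  · by_contra! h
    exact hxU (Set.mem_biUnion ⟨z, hz, rfl⟩ (Or.inl ⟨hxJ, h⟩))
  · by_contra! h
    exact hxU (Set.mem_biUnion ⟨z, hz, rfl⟩ (Or.inr ⟨hxJ, h⟩))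

/-- Between points of a core, membership in `◇X` is constant as soon as membership in `X` depends
only on the colour. -/
theorem mem_dia_of_mem_colourCore {W T : Type} {R : W → W → Prop} {τ : W → T} {J X : Set W}
    (hcon : ∀ x y, R x y ∨ x = y ∨ R y x) (hJ : RelConvex R J)
    (hX : ∀ x ∈ J, ∀ y ∈ J, τ x = τ y → x ∈ X → y ∈ X) {x y : W} (hx : x ∈ J)
    (hyJ : y ∈ J) (hy : ∀ z ∈ J, ∃ u ∈ J, τ u = τ z ∧ R y u)
    (h : ∃ z ∈ X, R x z) : ∃ z ∈ X, R y z := by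
  obtain ⟨z, hzX, hxz⟩ := h
  by_cases hzJ : z ∈ J
  · obtain ⟨u, hu, huz, hyu⟩ := hy z hzJ
    exact ⟨u, hX z hzJ u hu huz.symm hzX, hyu⟩
  · rcases hcon y z with h | rfl | h
    · exact ⟨z, hzX, h⟩
    · exact absurd hyJ hzJ
    · exact absurd (hJ hx hyJ hxz h) hzJ

/-- Every generated set is eventually determined by the generators along the iterated cores. -/
theorem tgenBy.exists_determined {W : Type} {R : W → W → Prop} {G : Set (Set W)} {X : Set W}
    (hcon : ∀ x y, R x y ∨ x = y ∨ R y x) {J : ℕ → Set W} (hanti : Antitone J)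
    (hJ : ∀ n, RelConvex R (J n))
    (hcore : ∀ n, J (n + 1) = colourCore R (fun x => {g ∈ G | x ∈ g}) (J n))
    (hX : tgenBy R G X) :
    ∃ n, ∀ x ∈ J n, ∀ y ∈ J n, {g ∈ G | x ∈ g} = {g ∈ G | y ∈ g} → x ∈ X → y ∈ X := by
  induction hX with
  | @basic X hX =>
    refine ⟨0, fun x _ y _ h hx => ?_⟩
    have : X ∈ {g ∈ G | y ∈ g} := h ▸ ⟨hX, hx⟩
    exact this.2
  | empty => exact ⟨0, fun _ _ _ _ _ h => h⟩
  | univ => exact ⟨0, fun _ _ _ _ _ h => h⟩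
  | inter _ _ ih₁ ih₂ =>
    obtain ⟨m, hm⟩ := ih₁
    obtain ⟨n, hn⟩ := ih₂
    have h₁ := hanti (le_max_left m n)
    have h₂ := hanti (le_max_right m n)
    exact ⟨max m n, fun x hx y hy h hxX =>
      ⟨hm x (h₁ hx) y (h₁ hy) h hxX.1, hn x (h₂ hx) y (h₂ hy) h hxX.2⟩⟩
  | compl _ ih =>
    obtain ⟨n, hn⟩ := ih
    exact ⟨n, fun x hx y hy h hxX hyX => hxX (hn y hy x hx h.symm hyX)⟩
  | diaF _ ih =>
    obtain ⟨n, hn⟩ := ih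
    refine ⟨n + 1, fun x hx y hy _ hxX => ?_⟩
    rw [hcore] at hx hy
    exact mem_dia_of_mem_colourCore hcon (hJ n) hn hx.1 hy.1 (fun z hz => (hy.2 z hz).1) hxX
  | diaP _ ih =>
    obtain ⟨n, hn⟩ := ih
    refine ⟨n + 1, fun x hx y hy _ hxX => ?_⟩
    rw [hcore] at hx hy
    exact mem_dia_of_mem_colourCore (R := flip R)
      (fun x y => (hcon y x).imp id (Or.imp Eq.symm id)) (hJ n).flip hn hx.1 hy.1
      (fun z hz => (hy.2 z hz).2) hxX

/-- a finitely generated descriptive temporal frame has a countable set of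
worlds (Lemma `tem-count`). -/
theorem temporal_finitely_generated_countable (W : Type) (F : TFrame W)
    (hg : F.IsGeneral) (hfg : F.FinGenerated) (hd : F.Descriptive) :
    Countable W := by
  obtain ⟨-, htr, hcon, -⟩ := hg
  obtain ⟨G, hG, hP⟩ := hfg
  have hsep := hd.1
  by_contra hunc
  have htr' : ∀ ⦃x y z⦄, F.R x y → F.R y z → F.R x z := fun x y z h₁ h₂ => htr h₁ h₂
  set τ : W → Set (Set W) := fun x => {g ∈ G | x ∈ g}
  have hfin : (Set.range τ).Finite := by
    refine hG.finite_subsets.subset ?_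
    rintro _ ⟨x, rfl⟩
    exact fun g hg => hg.1
  have hfinK (K : Set W) : (τ '' K).Finite := hfin.subset (Set.image_subset_range _ _)
  obtain ⟨I, ⟨hI, hIunc⟩, hImin⟩ : ∃ I, (RelConvex F.R I ∧ ¬ I.Countable) ∧
      ∀ K ⊆ I, RelConvex F.R K → ¬ K.Countable → τ '' I ⊆ τ '' K := by
    obtain ⟨I, hI, hmin⟩ := exists_minimalFor_of_wellFoundedLT
      (fun K : Set W => RelConvex F.R K ∧ ¬ K.Countable) (fun K => (τ '' K).ncard)
      ⟨Set.univ, fun _ _ _ _ _ _ _ => trivial, fun h => hunc (Set.countable_univ_iff.1 h)⟩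
    refine ⟨I, hI, fun K hKI hK hKunc => ?_⟩
    have hsub := Set.image_mono (f := τ) hKI
    exact (Set.eq_of_subset_of_ncard_le hsub
      (hmin ⟨hK, hKunc⟩ (Set.ncard_le_ncard hsub (hfinK I))) (hfinK I)).ge
  set J : ℕ → Set W := fun n => (colourCore F.R τ)^[n] I
  have hcore (n : ℕ) : J (n + 1) = colourCore F.R τ (J n) :=
    Function.iterate_succ_apply' _ _ _
  have hanti : Antitone J := antitone_nat_of_succ_le fun n => by
    rw [hcore]
    exact fun x hx => hx.1
  have hJ (n : ℕ) : RelConvex F.R (J n) := by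
    induction n with
    | zero => exact hI
    | succ n ih => rw [hcore]; exact ih.colourCore τ htr'
  have hdiff (n : ℕ) : (J n \ J (n + 1)).Countable := by
    rw [hcore]
    have hJI : J n ⊆ I := hanti (Nat.zero_le n)
    exact countable_diff_colourCore htr' hcon hfin (hJ n) fun K hK hKc hKunc =>
      (Set.image_mono hJI).trans (hImin K (hK.trans hJI) hKc hKunc)
  have hinter : (⋂ n, J n).Finite := by
    refine Set.Finite.of_finite_image (hfinK _) fun x hx y hy hxy => ?_
    have key : ∀ X ∈ F.P, ∀ x ∈ ⋂ n, J n, ∀ y ∈ ⋂ n, J n, τ x = τ y → x ∈ X → y ∈ X := by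
      intro X hX x hx y hy h
      rw [hP] at hX
      obtain ⟨n, hn⟩ := tgenBy.exists_determined hcon hanti hJ hcore hX
      exact hn x (Set.mem_iInter.1 hx n) y (Set.mem_iInter.1 hy n) h
    exact hsep x y fun X hX => ⟨key X hX x hx y hy hxy, key X hX y hy x hx hxy.symm⟩
  refine hIunc ((hinter.countable.union (Set.countable_iUnion hdiff)).mono fun x hx => ?_)
  by_contra hxn
  have hall (n : ℕ) : x ∈ J n := by
    induction n with
    | zero => exact hx
    | succ n ih =>
      by_contra h
      exact hxn (Or.inr (Set.mem_iUnion.2 ⟨n, ih, h⟩))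
  exact hxn (Or.inl (Set.mem_iInter.2 hall))
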